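/- arXiv:2312.16554 — 9 statements merged into one kernel-verified Lean document; each statement's English description precedes it below -/
import Mathlib

section
/- Let k, K, q, σ, X be positive real numbers with k·σ²/(q·K) < X. Then √(q/(σ²·(X − k·σ²/(q·K)))) ≥ 2·√k/(√K·X), and equality holds if and only if σ²/q = K·X/(2·k). -/
theorem stmt_1 (k K q σ X : ℝ) (hk : 0 < k) (hK : 0 < K) (hq : 0 < q)
    (hσ : 0 < σ) (hX : 0 < X) (h : k * σ ^ 2 / (q * K) < X) :
    Real.sqrt (q / (σ ^ 2 * (X - k * σ ^ 2 / (q * K)))) ≥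
      2 * Real.sqrt k / (Real.sqrt K * X) ∧
    (Real.sqrt (q / (σ ^ 2 * (X - k * σ ^ 2 / (q * K)))) =
        2 * Real.sqrt k / (Real.sqrt K * X) ↔ σ ^ 2 / q = K * X / (2 * k)) := by
  obtain ⟨s, hs⟩ : ∃ s, s = σ ^ 2 / q := ⟨_, rfl⟩
  have hs0 : 0 < s := by rw [hs]; positivity
  have hσs : σ ^ 2 = s * q := by rw [hs]; field_simp
  obtain ⟨D, hD⟩ : ∃ D, D = X - k * σ ^ 2 / (q * K) := ⟨_, rfl⟩
  have hD0 : 0 < D := by rw [hD]; linarith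
  have hDs : K * D = K * X - k * s := by
    rw [hD, hσs]; field_simp
  have hA : q / (σ ^ 2 * D) = 1 / (s * D) := by
    rw [hσs]; field_simp
  have hB : 2 * Real.sqrt k / (Real.sqrt K * X) = Real.sqrt (4 * k / (K * X ^ 2)) := by
    symm
    rw [Real.sqrt_eq_iff_mul_self_eq (by positivity) (by positivity)]
    rw [div_mul_div_comm]
    have h1 := Real.mul_self_sqrt hk.le
    have h2 := Real.mul_self_sqrt hK.le
    rw [show 2 * √k * (2 * √k) = 4 * (√k * √k) by ring,
      show √K * X * (√K * X) = (√K * √K) * X ^ 2 by ring, h1, h2]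
  have key : 1 / (s * D) - 4 * k / (K * X ^ 2)
      = (K * X - 2 * k * s) ^ 2 / (K ^ 2 * X ^ 2 * (s * D)) := by
    field_simp
    linear_combination (-4 * k * s) * hDs
  rw [← hD, ← hs, hA, hB]
  refine ⟨Real.sqrt_le_sqrt ?_, ?_⟩
  · have : 0 ≤ (K * X - 2 * k * s) ^ 2 / (K ^ 2 * X ^ 2 * (s * D)) := by positivity
    linarith
  · rw [Real.sqrt_inj (by positivity) (by positivity), ← sub_eq_zero, key,
      div_eq_zero_iff, or_iff_left (by positivity), sq_eq_zero_iff, eq_div_iff (by positivity)]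
    constructor <;> intro h <;> linarith
end

section
/- Let k, K > 0 and let T, σ, q, T', σ', q' be positive real numbers such that k·σ²·T = q·K. If 1/T' + k·σ'²/(q'·K) ≤ 1/T + k·σ²/(q·K), then √(q'·T')/σ' ≥ √(q·T)/σ. Consequently, for the objectives (f₁, f₂), any point satisfying k·σ²·T = q·K cannot be Pareto-dominated by any other point of positive coordinates. -/
theorem aux_sqrt (T σ q : ℝ) (hσ : 0 < σ) (hT : 0 < T) (hq : 0 < q) :
    Real.sqrt (q * T) / σ = Real.sqrt (q * T / σ ^ 2) := by
  rw [Real.sqrt_div (by positivity), Real.sqrt_sq hσ.le]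

theorem aux_prod (k K T σ q : ℝ) (hk : 0 < k) (hK : 0 < K)
    (hT : 0 < T) (hσ : 0 < σ) (hq : 0 < q) :
    q * T / σ ^ 2 = (k / K) / ((1 / T) * (k * σ ^ 2 / (q * K))) := by
  field_simp

theorem aux_eq (k K T σ q : ℝ) (hK : 0 < K) (hT : 0 < T) (hq : 0 < q)
    (heq : k * σ ^ 2 * T = q * K) : k * σ ^ 2 / (q * K) = 1 / T := by
  rw [div_eq_div_iff (by positivity) (by positivity)]
  linarith

theorem aux_le (k K T σ q T' σ' q' : ℝ) (hk : 0 < k) (hK : 0 < K)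
    (hT : 0 < T) (hσ : 0 < σ) (hq : 0 < q)
    (hT' : 0 < T') (hσ' : 0 < σ') (hq' : 0 < q')
    (heq : k * σ ^ 2 * T = q * K)
    (h : 1 / T' + k * σ' ^ 2 / (q' * K) ≤ 1 / T + k * σ ^ 2 / (q * K)) :
    Real.sqrt (q * T) / σ ≤ Real.sqrt (q' * T') / σ' := by
  rw [aux_sqrt T σ q hσ hT hq, aux_sqrt T' σ' q' hσ' hT' hq',
    aux_prod k K T σ q hk hK hT hσ hq, aux_prod k K T' σ' q' hk hK hT' hσ' hq']
  rw [aux_eq k K T σ q hK hT hq heq] at h ⊢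
  have ha : 0 < 1 / T := by positivity
  have ha' : 0 < 1 / T' := by positivity
  have hb' : 0 < k * σ' ^ 2 / (q' * K) := by positivity
  generalize 1 / T = a at *
  generalize 1 / T' = a' at *
  generalize k * σ' ^ 2 / (q' * K) = b' at *
  apply Real.sqrt_le_sqrt
  apply div_le_div_of_nonneg_left (by positivity) (by positivity)
  nlinarith [sq_nonneg (a' - b')]

theorem aux_lt (k K T σ q T' σ' q' : ℝ) (hk : 0 < k) (hK : 0 < K)
    (hT : 0 < T) (hσ : 0 < σ) (hq : 0 < q)
    (hT' : 0 < T') (hσ' : 0 < σ') (hq' : 0 < q')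
    (heq : k * σ ^ 2 * T = q * K)
    (h : 1 / T' + k * σ' ^ 2 / (q' * K) < 1 / T + k * σ ^ 2 / (q * K)) :
    Real.sqrt (q * T) / σ < Real.sqrt (q' * T') / σ' := by
  rw [aux_sqrt T σ q hσ hT hq, aux_sqrt T' σ' q' hσ' hT' hq',
    aux_prod k K T σ q hk hK hT hσ hq, aux_prod k K T' σ' q' hk hK hT' hσ' hq']
  rw [aux_eq k K T σ q hK hT hq heq] at h ⊢
  have ha : 0 < 1 / T := by positivity
  have ha' : 0 < 1 / T' := by positivity
  have hb' : 0 < k * σ' ^ 2 / (q' * K) := by positivity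
  generalize 1 / T = a at *
  generalize 1 / T' = a' at *
  generalize k * σ' ^ 2 / (q' * K) = b' at *
  apply Real.sqrt_lt_sqrt (by positivity)
  apply div_lt_div_of_pos_left (by positivity) (by positivity)
  nlinarith [sq_nonneg (a' - b')]

theorem stmt_3 (k K T σ q T' σ' q' : ℝ) (hk : 0 < k) (hK : 0 < K)
    (hT : 0 < T) (hσ : 0 < σ) (hq : 0 < q)
    (hT' : 0 < T') (hσ' : 0 < σ') (hq' : 0 < q')
    (heq : k * σ ^ 2 * T = q * K) :
    (1 / T' + k * σ' ^ 2 / (q' * K) ≤ 1 / T + k * σ ^ 2 / (q * K) →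
      Real.sqrt (q' * T') / σ' ≥ Real.sqrt (q * T) / σ) ∧
    -- Consequently, (T, σ, q) cannot be Pareto-dominated by any other point
    -- of positive coordinates for the objectives (f₁, f₂).
    ¬ ∃ T'' σ'' q'' : ℝ, 0 < T'' ∧ 0 < σ'' ∧ 0 < q'' ∧
      (1 / T'' + k * σ'' ^ 2 / (q'' * K) ≤ 1 / T + k * σ ^ 2 / (q * K) ∧
        Real.sqrt (q'' * T'') / σ'' ≤ Real.sqrt (q * T) / σ) ∧
      (1 / T'' + k * σ'' ^ 2 / (q'' * K) < 1 / T + k * σ ^ 2 / (q * K) ∨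
        Real.sqrt (q'' * T'') / σ'' < Real.sqrt (q * T) / σ) := by
  refine ⟨fun h => aux_le k K T σ q T' σ' q' hk hK hT hσ hq hT' hσ' hq' heq h, ?_⟩
  rintro ⟨t, s, r, ht, hs, hr, ⟨h1, h2⟩, h | h⟩
  · exact absurd (aux_lt k K T σ q t s r hk hK hT hσ hq ht hs hr heq h) (not_lt.mpr h2)
  · exact absurd (aux_le k K T σ q t s r hk hK hT hσ hq ht hs hr heq h1) (not_le.mpr h)
end

section
/- Let k, K > 0 and consider the feasible set D = {(T, σ, q) : T > 0, σ > 0, 0 < q ≤ 1} (T, σ real) with objectives f₁(T, σ, q) = 1/T + k·σ²/(q·K) and f₂(T, σ, q) = √(q·T)/σ. Then a point (T, σ, q) ∈ D is Pareto optimal on D if and only if k·σ²·T = q·K. -/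
/-- Pareto optimality of a point `x` of a feasible set `D` for objectives `(f₁, f₂)`:
`x ∈ D` and no `y ∈ D` Pareto-dominates `x`. -/
def ParetoOptimal {α : Type*} (D : Set α) (f₁ f₂ : α → ℝ) (x : α) : Prop :=
  x ∈ D ∧ ¬ ∃ y ∈ D, (f₁ y ≤ f₁ x ∧ f₂ y ≤ f₂ x) ∧ (f₁ y < f₁ x ∨ f₂ y < f₂ x)

lemma f2_eq (k K T s q : ℝ) (hk : 0 < k) (hK : 0 < K) (hT : 0 < T) (hs : 0 < s) (hq : 0 < q) :
    Real.sqrt (q * T) / s = Real.sqrt (k / K / (1 / T * (k * s ^ 2 / (q * K)))) := by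
  have h : k / K / (1 / T * (k * s ^ 2 / (q * K))) = (q * T) / s ^ 2 := by
    field_simp
  rw [h, Real.sqrt_div (by positivity), Real.sqrt_sq hs.le]

lemma f2_le_iff (c x y : ℝ) (hc : 0 < c) (hx : 0 < x) (hy : 0 < y) :
    Real.sqrt (c / x) ≤ Real.sqrt (c / y) ↔ y ≤ x := by
  rw [Real.sqrt_le_sqrt_iff (by positivity), div_le_div_iff_of_pos_left hc hx hy]

lemma f2_lt_iff (c x y : ℝ) (hc : 0 < c) (hx : 0 < x) (hy : 0 < y) :
    Real.sqrt (c / x) < Real.sqrt (c / y) ↔ y < x := by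
  rw [← not_le, f2_le_iff c y x hc hy hx, not_le]

theorem stmt_5 (k K : ℝ) (hk : 0 < k) (hK : 0 < K)
    (D : Set (ℝ × ℝ × ℝ))
    (hD : D = {p : ℝ × ℝ × ℝ | 0 < p.1 ∧ 0 < p.2.1 ∧ 0 < p.2.2 ∧ p.2.2 ≤ 1})
    (f₁ f₂ : ℝ × ℝ × ℝ → ℝ)
    (hf₁ : f₁ = fun p => 1 / p.1 + k * p.2.1 ^ 2 / (p.2.2 * K))
    (hf₂ : f₂ = fun p => Real.sqrt (p.2.2 * p.1) / p.2.1) :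
    ∀ p ∈ D, (ParetoOptimal D f₁ f₂ p ↔ k * p.2.1 ^ 2 * p.1 = p.2.2 * K) := by
  subst hD hf₁ hf₂
  rintro ⟨T, s, q⟩ ⟨hT, hs, hq, hq1⟩
  simp only at hT hs hq hq1 ⊢
  have hc : 0 < k / K := by positivity
  have ha : 0 < 1 / T := by positivity
  have hb : 0 < k * s ^ 2 / (q * K) := by positivity
  have key : k * s ^ 2 * T = q * K ↔ k * s ^ 2 / (q * K) = 1 / T := by
    rw [div_eq_div_iff (by positivity) (by positivity), one_mul]
  rw [key]
  constructor
  · rintro ⟨-, h⟩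
    by_contra hne
    apply h
    set a := 1 / T with hadef
    set b := k * s ^ 2 / (q * K) with hbdef
    set m := (a + b) / 2 with hm
    have hmp : 0 < m := by positivity
    have hs' : 0 < Real.sqrt (q * K * m / k) := Real.sqrt_pos.2 (by positivity)
    have hT' : 0 < 1 / m := by positivity
    have e1 : 1 / (1 / m) = m := by simp
    have e2 : k * Real.sqrt (q * K * m / k) ^ 2 / (q * K) = m := by
      rw [Real.sq_sqrt (by positivity)]
      field_simp
    have hlt : Real.sqrt (q * (1 / m)) / Real.sqrt (q * K * m / k) < Real.sqrt (q * T) / s := by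
      rw [f2_eq k K _ _ q hk hK hT' hs' hq, f2_eq k K T s q hk hK hT hs hq, e1, e2,
        f2_lt_iff _ _ _ hc (by positivity) (by positivity), ← hadef, ← hbdef]
      have : 0 < (b - a) ^ 2 := by
        have := sub_ne_zero.2 hne
        positivity
      rw [hm]
      nlinarith
    refine ⟨(1 / m, Real.sqrt (q * K * m / k), q), ⟨hT', hs', hq, hq1⟩, ⟨?_, hlt.le⟩, Or.inr hlt⟩
    simp only [e1, e2]
    rw [← hadef, ← hbdef, hm]
    linarith
  · intro hab
    refine ⟨⟨hT, hs, hq, hq1⟩, ?_⟩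
    rintro ⟨⟨T', s', q'⟩, ⟨hT', hs', hq', hq1'⟩, ⟨h1, h2⟩, h3⟩
    simp only at hT' hs' hq' hq1' h1 h2 h3
    have ha' : 0 < 1 / T' := by positivity
    have hb' : 0 < k * s' ^ 2 / (q' * K) := by positivity
    rw [f2_eq k K T' s' q' hk hK hT' hs' hq', f2_eq k K T s q hk hK hT hs hq] at h2 h3
    rw [f2_le_iff _ _ _ hc (by positivity) (by positivity)] at h2
    rw [f2_lt_iff _ _ _ hc (by positivity) (by positivity)] at h3
    rw [hab] at h1 h2 h3
    generalize 1 / T = a at *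
    generalize 1 / T' = a' at *
    generalize k * s' ^ 2 / (q' * K) = b' at *
    rcases h3 with h3 | h3
    · nlinarith [sq_nonneg (a' - b')]
    · nlinarith [sq_nonneg (a' - b')]
end

section
/- Let k, K > 0 and consider the feasible set D = {(T, σ, q) : T > 0, σ > 0, 0 < q ≤ 1} with objectives f₁(T, σ, q) = 1/T + k·σ²/(q·K) and f₂(T, σ, q) = √(q·T)/σ. Then the Pareto front, i.e. the set {(f₁(p), f₂(p)) : p ∈ D is Pareto optimal on D}, equals the curve {(X, 2·√(k/K)/X) : X > 0}. -/
theorem stmt_7 (k K : ℝ) (hk : 0 < k) (hK : 0 < K)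
    (D : Set (ℝ × ℝ × ℝ))
    (hD : D = {p : ℝ × ℝ × ℝ | 0 < p.1 ∧ 0 < p.2.1 ∧ 0 < p.2.2 ∧ p.2.2 ≤ 1})
    (f₁ f₂ : ℝ × ℝ × ℝ → ℝ)
    (hf₁ : f₁ = fun p => 1 / p.1 + k * p.2.1 ^ 2 / (p.2.2 * K))
    (hf₂ : f₂ = fun p => Real.sqrt (p.2.2 * p.1) / p.2.1) :
    {y : ℝ × ℝ | ∃ p, ParetoOptimal D f₁ f₂ p ∧ y = (f₁ p, f₂ p)} =
      {y : ℝ × ℝ | ∃ X : ℝ, 0 < X ∧ y = (X, 2 * Real.sqrt (k / K) / X)} := by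
  obtain ⟨c, hc, hck⟩ : ∃ c : ℝ, 0 < c ∧ Real.sqrt (k / K) = c :=
    ⟨_, Real.sqrt_pos.mpr (div_pos hk hK), rfl⟩
  have hc2 : k = c ^ 2 * K := by
    rw [← hck, Real.sq_sqrt (div_pos hk hK).le]; field_simp
  rw [hck]
  have H1 : ∀ p ∈ D, 0 < f₁ p ∧ 2 * c / f₁ p ≤ f₂ p := by
    rintro ⟨T, σ, q⟩ hp
    rw [hD] at hp
    obtain ⟨hT, hσ, hq, -⟩ := hp
    simp only at hT hσ hq
    have hpos : 0 < f₁ (T, σ, q) := by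
      rw [hf₁]; simp only; positivity
    refine ⟨hpos, ?_⟩
    rw [div_le_iff₀ hpos, hf₁, hf₂]
    simp only
    obtain ⟨s, hs, hsq⟩ : ∃ s : ℝ, 0 < s ∧ Real.sqrt (q * T) = s :=
      ⟨_, Real.sqrt_pos.mpr (mul_pos hq hT), rfl⟩
    have hs2 : s ^ 2 = q * T := by rw [← hsq, Real.sq_sqrt (mul_pos hq hT).le]
    rw [hsq, hc2]
    have hq' : q = s ^ 2 / T := by rw [hs2]; field_simp
    have key : s / σ * (1 / T + c ^ 2 * K * σ ^ 2 / (q * K)) - 2 * c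
        = (s - c * σ * T) ^ 2 / (s * σ * T) := by
      rw [hq']; field_simp; ring
    have : 0 ≤ (s - c * σ * T) ^ 2 / (s * σ * T) := by positivity
    linarith
  have H2 : ∀ X : ℝ, 0 < X → ∃ p ∈ D, f₁ p = X ∧ f₂ p = 2 * c / X := by
    intro X hX
    obtain ⟨r, hr, hrX⟩ : ∃ r : ℝ, 0 < r ∧ X = 2 * r ^ 2 :=
      ⟨Real.sqrt (X / 2), Real.sqrt_pos.mpr (by positivity), by
        rw [Real.sq_sqrt (by positivity)]; ring⟩
    refine ⟨((1 / r) ^ 2, r / c, 1), ?_, ?_, ?_⟩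
    · rw [hD]
      exact ⟨by positivity, by positivity, one_pos, le_refl _⟩
    · rw [hf₁, hrX, hc2]; simp only; field_simp; ring
    · rw [hf₂, hrX]; simp only
      rw [one_mul, Real.sqrt_sq (by positivity)]; field_simp
  ext y
  constructor
  · rintro ⟨p, ⟨hp, hopt⟩, rfl⟩
    obtain ⟨hpos, hle⟩ := H1 p hp
    refine ⟨f₁ p, hpos, ?_⟩
    obtain ⟨p', hp', h1, h2⟩ := H2 _ hpos
    rcases hle.lt_or_eq with h | h
    · exact absurd ⟨p', hp', ⟨h1.le, h2.le.trans hle⟩, Or.inr (h2.trans_lt h)⟩ hopt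
    · rw [h]
  · rintro ⟨X, hX, rfl⟩
    obtain ⟨p, hp, h1, h2⟩ := H2 X hX
    refine ⟨p, ⟨hp, ?_⟩, by rw [h1, h2]⟩
    rintro ⟨y, hy, ⟨g1, g2⟩, g3⟩
    obtain ⟨hpos, hle⟩ := H1 y hy
    rw [h1] at g1 g3
    rw [h2] at g2 g3
    rcases g3 with g | g
    · have : 2 * c / X < 2 * c / f₁ y := div_lt_div_of_pos_left (by positivity) hpos g
      linarith
    · have : 2 * c / X ≤ 2 * c / f₁ y := div_le_div_of_nonneg_left (by positivity) hpos g1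
      linarith
end

section
/- Let k, K > 0 and let q with 0 < q ≤ 1 be a fixed sample ratio. Consider the feasible set D = {(T, σ) : T > 0, σ > 0} (T, σ real) with objectives g₁(T, σ) = 1/T + k·σ²/(q·K) and g₂(T, σ) = √(q·T)/σ. Then a point (T, σ) ∈ D is Pareto optimal on D if and only if k·σ²·T = q·K. -/
lemma g2_le_iff (q T s U r : ℝ) (hq : 0 < q) (hT : 0 < T) (hs : 0 < s) (hU : 0 < U)
    (hr : 0 < r) :
    Real.sqrt (q * U) / r ≤ Real.sqrt (q * T) / s ↔ U * s ^ 2 ≤ T * r ^ 2 := by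
  rw [div_le_div_iff₀ hr hs, ← pow_le_pow_iff_left₀ (by positivity) (by positivity) two_ne_zero,
    mul_pow, mul_pow, Real.sq_sqrt (by positivity), Real.sq_sqrt (by positivity), mul_assoc,
    mul_assoc, mul_le_mul_iff_right₀ hq]

theorem stmt_8 (k K q : ℝ) (hk : 0 < k) (hK : 0 < K) (hq : 0 < q) (hq1 : q ≤ 1)
    (D : Set (ℝ × ℝ)) (hD : D = {p : ℝ × ℝ | 0 < p.1 ∧ 0 < p.2})
    (g₁ g₂ : ℝ × ℝ → ℝ)
    (hg₁ : g₁ = fun p => 1 / p.1 + k * p.2 ^ 2 / (q * K))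
    (hg₂ : g₂ = fun p => Real.sqrt (q * p.1) / p.2) :
    ∀ p ∈ D, (ParetoOptimal D g₁ g₂ p ↔ k * p.2 ^ 2 * p.1 = q * K) := by
  subst hD hg₁ hg₂
  rintro ⟨T, s⟩ ⟨hT, hs⟩
  simp only at hT hs
  obtain ⟨a, ha⟩ : ∃ a, a = k / (q * K) := ⟨_, rfl⟩
  have ha0 : 0 < a := by rw [ha]; positivity
  have hform : ∀ x : ℝ, k * x ^ 2 / (q * K) = a * x ^ 2 := by
    intro x; rw [ha]; ring
  have hcond : k * s ^ 2 * T = q * K ↔ a * s ^ 2 * T = 1 := by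
    have hne : q * K ≠ 0 := by positivity
    rw [ha, div_mul_eq_mul_div, div_mul_eq_mul_div, div_eq_one_iff_eq hne]
  simp only [ParetoOptimal, hform, Set.mem_ofPred_eq, Prod.exists]
  rw [hcond]
  constructor
  · rintro ⟨-, hno⟩
    by_contra hne
    apply hno
    obtain ⟨m, hm0, hm⟩ : ∃ m : ℝ, 0 < m ∧ m ^ 2 * (a * s ^ 2) = T := by
      refine ⟨Real.sqrt (T / (a * s ^ 2)), by positivity, ?_⟩
      rw [Real.sq_sqrt (by positivity)]
      field_simp
    have hs2 : (s * Real.sqrt (m / T)) ^ 2 = s ^ 2 * (m / T) := by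
      rw [mul_pow, Real.sq_sqrt (by positivity)]
    have hs0 : 0 < s * Real.sqrt (m / T) := by positivity
    have hmT : T - m ≠ 0 := by
      intro h
      have h1 : m = T := by linarith
      subst h1
      apply hne
      have : m * (a * s ^ 2 * m) = m * 1 := by linarith
      exact mul_left_cancel₀ (ne_of_gt hm0) this
    have has : a * s ^ 2 = T / m ^ 2 := by
      field_simp; linarith
    have hlt : 1 / m + a * (s * Real.sqrt (m / T)) ^ 2 < 1 / T + a * s ^ 2 := by
      rw [hs2, ← mul_assoc, has, ← sub_pos]
      have : 1 / T + T / m ^ 2 - (1 / m + T / m ^ 2 * (m / T)) = (T - m) ^ 2 / (T * m ^ 2) := by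
        field_simp; ring
      rw [this]; positivity
    refine ⟨m, s * Real.sqrt (m / T), ⟨hm0, hs0⟩, ⟨hlt.le, ?_⟩, Or.inl hlt⟩
    rw [g2_le_iff q T s m _ hq hT hs hm0 hs0, hs2]
    apply le_of_eq
    field_simp
  · intro h1
    refine ⟨⟨hT, hs⟩, ?_⟩
    rintro ⟨U, r, ⟨hU, hr⟩, ⟨hle1, hle2⟩, hlt⟩
    rw [g2_le_iff q T s U r hq hT hs hU hr] at hle2
    have has : a * s ^ 2 = 1 / T := by field_simp; linarith
    have hb : U / T ^ 2 ≤ a * r ^ 2 := by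
      have h2 : a * (U * s ^ 2) ≤ a * (T * r ^ 2) := mul_le_mul_of_nonneg_left hle2 ha0.le
      have h3 : a * (U * s ^ 2) = U / T := by
        rw [mul_left_comm, has]; ring
      rw [h3] at h2
      have h4 : U / T ^ 2 = U / T / T := by field_simp
      rw [h4, div_le_iff₀ hT]; linarith
    have hid : 1 / U + U / T ^ 2 - (1 / T + 1 / T) = (U - T) ^ 2 / (U * T ^ 2) := by
      field_simp; ring
    have hnn : 0 ≤ (U - T) ^ 2 / (U * T ^ 2) := by positivity
    rw [has] at hle1 hlt
    rcases hlt with h | h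
    · linarith
    · have h0 : (U - T) ^ 2 / (U * T ^ 2) = 0 := by linarith
      have hTT : U = T := by
        rw [div_eq_zero_iff] at h0
        rcases h0 with h0 | h0
        · have := pow_eq_zero_iff (two_ne_zero) |>.1 h0
          linarith
        · exact absurd h0 (by positivity)
      subst hTT
      apply not_le.2 h
      rw [g2_le_iff q _ _ _ _ hq hT hr hT hs]
      apply mul_le_mul_of_nonneg_left _ hT.le
      have h5 : U / U ^ 2 = 1 / U := by field_simp
      rw [h5] at hb
      have h6 : a * r ^ 2 ≤ a * s ^ 2 := by linarith
      exact le_of_mul_le_mul_left h6 ha0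
end

section
/- Let k, K, q, σ_max > 0, let T_max be a positive integer, and assume k·σ_max²·T_max > q·K. Consider the feasible set D = {(T, σ) : T ∈ {1, …, T_max}, 0 < σ ≤ σ_max} with objectives g₁(T, σ) = 1/T + k·σ²/(q·K) and g₂(T, σ) = √(q·T)/σ. Then for every integer T₀ with 1 ≤ T₀ ≤ q·K/(k·σ_max²), the point (T₀, σ_max) is Pareto optimal on D. -/
theorem stmt_10 (k K q σmax : ℝ) (hk : 0 < k) (hK : 0 < K) (hq : 0 < q)
    (hσmax : 0 < σmax) (Tmax : ℕ) (hTmax : 0 < Tmax)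
    (hcase : k * σmax ^ 2 * (Tmax : ℝ) > q * K)
    (D : Set (ℕ × ℝ))
    (hD : D = {p : ℕ × ℝ | 1 ≤ p.1 ∧ p.1 ≤ Tmax ∧ 0 < p.2 ∧ p.2 ≤ σmax})
    (g₁ g₂ : ℕ × ℝ → ℝ)
    (hg₁ : g₁ = fun p => 1 / (p.1 : ℝ) + k * p.2 ^ 2 / (q * K))
    (hg₂ : g₂ = fun p => Real.sqrt (q * (p.1 : ℝ)) / p.2) :
    ∀ T₀ : ℕ, 1 ≤ T₀ → (T₀ : ℝ) ≤ q * K / (k * σmax ^ 2) →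
      ParetoOptimal D g₁ g₂ (T₀, σmax) := by
  intro T₀ hT₀ hle
  subst hD hg₁ hg₂
  have hT₀' : (0:ℝ) < T₀ := by exact_mod_cast hT₀
  have hkσ : 0 < k * σmax ^ 2 := by positivity
  have hqK : 0 < q * K := by positivity
  have hle' : (T₀ : ℝ) * (k * σmax ^ 2) ≤ q * K := (le_div_iff₀ hkσ).1 hle
  refine ⟨⟨hT₀, ?_, hσmax, le_refl _⟩, ?_⟩
  · have h : (T₀ : ℝ) < Tmax := by
      by_contra hc
      push Not at hc
      nlinarith [mul_le_mul_of_nonneg_left hc hkσ.le]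
    exact (by exact_mod_cast h : T₀ < Tmax).le
  · rintro ⟨⟨T, s⟩, ⟨hT1, hT2, hs0, hs⟩, ⟨h1, h2⟩, h3⟩
    dsimp only at *
    have hT : (0:ℝ) < T := by exact_mod_cast hT1
    have hsq : (T : ℝ) * σmax ^ 2 ≤ T₀ * s ^ 2 := by
      rw [div_le_div_iff₀ hs0 hσmax] at h2
      have h4 := pow_le_pow_left₀ (by positivity) h2 2
      rw [mul_pow, mul_pow, Real.sq_sqrt (by positivity), Real.sq_sqrt (by positivity)] at h4
      have h5 : q * ((T : ℝ) * σmax ^ 2) ≤ q * (T₀ * s ^ 2) := by linarith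
      exact le_of_mul_le_mul_left h5 hq
    have hs2 : s ^ 2 ≤ σmax ^ 2 := pow_le_pow_left₀ hs0.le hs 2
    have hσ2 : 0 < σmax ^ 2 := by positivity
    have hTT : (T : ℝ) ≤ T₀ := by
      have : (T : ℝ) * σmax ^ 2 ≤ T₀ * σmax ^ 2 :=
        hsq.trans (mul_le_mul_of_nonneg_left hs2 hT₀'.le)
      exact le_of_mul_le_mul_right this hσ2
    have hge : (T₀ : ℝ) ≤ T := by
      by_contra hc
      push Not at hc
      have e1 : q * K * (T₀ - T) ≤ k * (σmax ^ 2 - s ^ 2) * (T * T₀) := by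
        have h6 : 1 / (T : ℝ) - 1 / T₀ ≤ k * (σmax ^ 2 - s ^ 2) / (q * K) := by
          rw [mul_sub, sub_div]; linarith
        rw [div_sub_div _ _ hT.ne' hT₀'.ne', div_le_div_iff₀ (by positivity) hqK] at h6
        linarith
      have e2 : k * T * (T * σmax ^ 2) ≤ k * T * (T₀ * s ^ 2) :=
        mul_le_mul_of_nonneg_left hsq (by positivity)
      have e3 : q * K * (T₀ - T) ≤ (k * σmax ^ 2 * T) * (T₀ - T) := by nlinarith
      have e4 := le_of_mul_le_mul_right e3 (sub_pos.2 hc)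
      nlinarith [mul_lt_mul_of_pos_left hc hkσ]
    have hEq : (T : ℝ) = T₀ := le_antisymm hTT hge
    have hsσ : s = σmax := by
      rw [hEq] at hsq
      have h7 := le_of_mul_le_mul_left hsq hT₀'
      exact le_antisymm hs (by nlinarith)
    rw [hEq, hsσ] at h3
    rcases h3 with h | h <;> exact lt_irrefl _ h
end

section
/- Let k, K, q, σ_max > 0, let T_max be a positive integer, and assume k·σ_max²·T_max > q·K. Consider the feasible set D = {(T, σ) : T ∈ {1, …, T_max}, 0 < σ ≤ σ_max} with objectives g₁(T, σ) = 1/T + k·σ²/(q·K) and g₂(T, σ) = √(q·T)/σ. Then for every integer T₀ with q·K/(k·σ_max²) ≤ T₀ ≤ T_max − 1, the point (T₀, √(q·K/(k·T₀))) belongs to D and is Pareto optimal on D. -/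
theorem stmt_11 (k K q σmax : ℝ) (hk : 0 < k) (hK : 0 < K) (hq : 0 < q)
    (hσmax : 0 < σmax) (Tmax : ℕ) (hTmax : 0 < Tmax)
    (hcase : k * σmax ^ 2 * (Tmax : ℝ) > q * K)
    (D : Set (ℕ × ℝ))
    (hD : D = {p : ℕ × ℝ | 1 ≤ p.1 ∧ p.1 ≤ Tmax ∧ 0 < p.2 ∧ p.2 ≤ σmax})
    (g₁ g₂ : ℕ × ℝ → ℝ)
    (hg₁ : g₁ = fun p => 1 / (p.1 : ℝ) + k * p.2 ^ 2 / (q * K))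
    (hg₂ : g₂ = fun p => Real.sqrt (q * (p.1 : ℝ)) / p.2) :
    ∀ T₀ : ℕ, q * K / (k * σmax ^ 2) ≤ (T₀ : ℝ) → T₀ ≤ Tmax - 1 →
      (T₀, Real.sqrt (q * K / (k * (T₀ : ℝ)))) ∈ D ∧
      ParetoOptimal D g₁ g₂ (T₀, Real.sqrt (q * K / (k * (T₀ : ℝ)))) := by
  intro T₀ h1 h2
  have hT : (0:ℝ) < T₀ := lt_of_lt_of_le (by positivity) h1
  have hTn : 0 < T₀ := by exact_mod_cast hT
  have hs0 : 0 < Real.sqrt (q * K / (k * (T₀ : ℝ))) := Real.sqrt_pos.mpr (by positivity)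
  have hsq : Real.sqrt (q * K / (k * (T₀ : ℝ))) ^ 2 = q * K / (k * (T₀ : ℝ)) :=
    Real.sq_sqrt (by positivity)
  generalize Real.sqrt (q * K / (k * (T₀ : ℝ))) = s at hs0 hsq ⊢
  have hqK : q * K = s ^ 2 * k * T₀ := by
    rw [hsq]; field_simp
  have hmem : (T₀, s) ∈ D := by
    rw [hD]
    refine ⟨hTn, by simp only; omega, hs0, ?_⟩
    simp only
    rw [div_le_iff₀ (by positivity), hqK] at h1
    have h3 : (k * T₀) * s ^ 2 ≤ (k * T₀) * σmax ^ 2 := by linarith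
    have h4 := le_of_mul_le_mul_left h3 (by positivity)
    exact (sq_le_sq₀ hs0.le hσmax.le).mp h4
  refine ⟨hmem, hmem, ?_⟩
  rintro ⟨⟨T, t⟩, hy, ⟨ha, hb⟩, hlt⟩
  have hy' := hy
  rw [hD] at hy'
  obtain ⟨hT1, -, ht, -⟩ := hy'
  simp only at hT1 ht
  have hTp : (0:ℝ) < T := by exact_mod_cast hT1
  have hb2 : (T:ℝ) * s ^ 2 ≤ T₀ * t ^ 2 := by
    rw [hg₂] at hb
    simp only at hb
    have h5 := pow_le_pow_left₀ (by positivity) hb 2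
    rw [div_pow, div_pow, Real.sq_sqrt (by positivity), Real.sq_sqrt (by positivity),
      div_le_div_iff₀ (by positivity) (by positivity)] at h5
    refine le_of_mul_le_mul_left (a := q) ?_ hq
    linarith
  have ha2 : T₀ * s ^ 2 + t ^ 2 * T ≤ 2 * T * s ^ 2 := by
    rw [hg₁] at ha
    simp only [hqK] at ha
    have e1 : 1 / (T:ℝ) + k * t ^ 2 / (s ^ 2 * k * T₀)
        = (T₀ * s ^ 2 + t ^ 2 * T) / (T * T₀ * s ^ 2) := by field_simp
    have e2 : 1 / (T₀:ℝ) + k * s ^ 2 / (s ^ 2 * k * T₀)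
        = (2 * T * s ^ 2) / (T * T₀ * s ^ 2) := by field_simp; norm_num
    rw [e1, e2] at ha
    exact (div_le_div_iff_of_pos_right (by positivity)).mp ha
  have h6 : s ^ 2 * ((T₀:ℝ) - T) ^ 2 ≤ 0 := by
    have := mul_le_mul_of_nonneg_left ha2 hT.le
    have := mul_le_mul_of_nonneg_left hb2 hTp.le
    nlinarith
  have h7 : ((T₀:ℝ) - T) ^ 2 ≤ 0 := by
    by_contra h
    push Not at h
    have : 0 < s ^ 2 * ((T₀:ℝ) - T) ^ 2 := by positivity
    linarith
  have h8 : (T₀:ℝ) = T := by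
    have := pow_eq_zero_iff (two_ne_zero) |>.mp (le_antisymm h7 (sq_nonneg _))
    linarith
  have h9 : T₀ = T := by exact_mod_cast h8
  subst h9
  have h10 : s ^ 2 ≤ t ^ 2 := le_of_mul_le_mul_left hb2 hT
  have h11 : t ^ 2 ≤ s ^ 2 := le_of_mul_le_mul_left (a := (T₀:ℝ)) (by linarith) hT
  have h12 : s = t := le_antisymm ((sq_le_sq₀ hs0.le ht.le).mp h10)
    ((sq_le_sq₀ ht.le hs0.le).mp h11)
  subst h12
  simp at hlt
end

section
/- Let k, K, q, σ_max > 0, let T_max be a positive integer, and assume k·σ_max²·T_max > q·K. Consider the feasible set D = {(T, σ) : T ∈ {1, …, T_max}, 0 < σ ≤ σ_max} with objectives g₁(T, σ) = 1/T + k·σ²/(q·K) and g₂(T, σ) = √(q·T)/σ. Then for every σ with 0 < σ ≤ √(q·K/(k·T_max)), the point (T_max, σ) belongs to D and is Pareto optimal on D. -/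
theorem stmt_12 (k K q σmax : ℝ) (hk : 0 < k) (hK : 0 < K) (hq : 0 < q)
    (hσmax : 0 < σmax) (Tmax : ℕ) (hTmax : 0 < Tmax)
    (hcase : k * σmax ^ 2 * (Tmax : ℝ) > q * K)
    (D : Set (ℕ × ℝ))
    (hD : D = {p : ℕ × ℝ | 1 ≤ p.1 ∧ p.1 ≤ Tmax ∧ 0 < p.2 ∧ p.2 ≤ σmax})
    (g₁ g₂ : ℕ × ℝ → ℝ)
    (hg₁ : g₁ = fun p => 1 / (p.1 : ℝ) + k * p.2 ^ 2 / (q * K))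
    (hg₂ : g₂ = fun p => Real.sqrt (q * (p.1 : ℝ)) / p.2) :
    ∀ σ : ℝ, 0 < σ → σ ≤ Real.sqrt (q * K / (k * (Tmax : ℝ))) →
      (Tmax, σ) ∈ D ∧ ParetoOptimal D g₁ g₂ (Tmax, σ) := by
  intro σ hσ hσle
  have hT : (0 : ℝ) < Tmax := by exact_mod_cast hTmax
  have ha : k * σ ^ 2 * Tmax ≤ q * K := by
    have h := (Real.le_sqrt hσ.le (by positivity)).1 hσle
    rw [le_div_iff₀ (by positivity)] at h
    linarith
  have hmem : (Tmax, σ) ∈ D := by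
    rw [hD]
    refine ⟨hTmax, le_refl _, hσ, ?_⟩
    have h1 : (k * Tmax) * σ ^ 2 ≤ (k * Tmax) * σmax ^ 2 := by linarith
    have h2 := le_of_mul_le_mul_left h1 (by positivity)
    exact (pow_le_pow_iff_left₀ hσ.le hσmax.le two_ne_zero).1 h2
  refine ⟨hmem, hmem, ?_⟩
  rintro ⟨⟨t, s⟩, hy, ⟨h1, h2⟩, h3⟩
  rw [hD] at hy
  obtain ⟨ht1, htT, hs, -⟩ := hy
  simp only at ht1 htT hs
  have ht : (0 : ℝ) < t := by exact_mod_cast ht1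
  have hm : 0 < q * K := by positivity
  have h2' := h2
  have h1' := h1
  simp only [hg₁] at h1'
  simp only [hg₂] at h2'
  have e2 : (t : ℝ) * σ ^ 2 ≤ Tmax * s ^ 2 := by
    have h := pow_le_pow_left₀ (by positivity) h2' 2
    rw [div_pow, div_pow, Real.sq_sqrt (by positivity), Real.sq_sqrt (by positivity),
      div_le_div_iff₀ (by positivity) (by positivity)] at h
    refine le_of_mul_le_mul_left (a := q) ?_ hq
    linarith
  have e1 : (Tmax : ℝ) * (q * K) + k * s ^ 2 * t * Tmax ≤ t * (q * K) + k * σ ^ 2 * t * Tmax := by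
    have h := mul_le_mul_of_nonneg_right h1' (show 0 ≤ (t : ℝ) * Tmax * (q * K) by positivity)
    have l1 : (1 / (t : ℝ) + k * s ^ 2 / (q * K)) * (t * Tmax * (q * K))
        = (Tmax : ℝ) * (q * K) + k * s ^ 2 * t * Tmax := by
      field_simp
    have l2 : (1 / (Tmax : ℝ) + k * σ ^ 2 / (q * K)) * (t * Tmax * (q * K))
        = (t : ℝ) * (q * K) + k * σ ^ 2 * t * Tmax := by
      field_simp
    rwa [l1, l2] at h
  have htt : t = Tmax := by
    by_contra hne
    have hlt : (t : ℝ) < Tmax := by exact_mod_cast lt_of_le_of_ne htT hne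
    have e3 : k * t * (t * σ ^ 2) ≤ k * t * (Tmax * s ^ 2) :=
      mul_le_mul_of_nonneg_left e2 (by positivity)
    have e4 : (q * K) * (Tmax - t) ≤ (k * σ ^ 2 * t) * (Tmax - t) := by linarith
    have e5 := le_of_mul_le_mul_right e4 (sub_pos.2 hlt)
    have e6 : k * σ ^ 2 * t < k * σ ^ 2 * Tmax :=
      mul_lt_mul_of_pos_left hlt (by positivity)
    linarith
  subst htt
  have f1 : σ ^ 2 ≤ s ^ 2 := le_of_mul_le_mul_left e2 ht
  have f2 : s ^ 2 ≤ σ ^ 2 := by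
    refine le_of_mul_le_mul_left (a := k * t * t) ?_ (by positivity)
    linarith
  have f3 : s = σ := (pow_left_inj₀ hs.le hσ.le two_ne_zero).1 (le_antisymm f2 f1)
  subst f3
  rcases h3 with h | h <;> exact lt_irrefl _ h
end

section
/- Let k, K, q, σ_max > 0, let T_max ≥ 1 be a real number, and assume k·σ_max²·T_max ≤ q·K. Consider the feasible set D = {(T, σ) : 1 ≤ T ≤ T_max, 0 < σ ≤ σ_max} (T real) with objectives g₁(T, σ) = 1/T + k·σ²/(q·K) and g₂(T, σ) = √(q·T)/σ. Then a point (T, σ) ∈ D is Pareto optimal on D if and only if σ = σ_max or T = T_max. -/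
theorem stmt_13 (k K q σmax Tmax : ℝ) (hk : 0 < k) (hK : 0 < K) (hq : 0 < q)
    (hσmax : 0 < σmax) (hTmax : 1 ≤ Tmax)
    (hcase : k * σmax ^ 2 * Tmax ≤ q * K)
    (D : Set (ℝ × ℝ))
    (hD : D = {p : ℝ × ℝ | 1 ≤ p.1 ∧ p.1 ≤ Tmax ∧ 0 < p.2 ∧ p.2 ≤ σmax})
    (g₁ g₂ : ℝ × ℝ → ℝ)
    (hg₁ : g₁ = fun p => 1 / p.1 + k * p.2 ^ 2 / (q * K))
    (hg₂ : g₂ = fun p => Real.sqrt (q * p.1) / p.2) :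
    ∀ p ∈ D, (ParetoOptimal D g₁ g₂ p ↔ p.2 = σmax ∨ p.1 = Tmax) := by
  rintro ⟨T, σ⟩ hp
  subst hD hg₁ hg₂
  obtain ⟨hT1, hT2, hσ1, hσ2⟩ := hp
  dsimp only at hT1 hT2 hσ1 hσ2
  have hT0 : 0 < T := by linarith
  have hTm0 : 0 < Tmax := by linarith
  obtain ⟨c, hc⟩ : ∃ c, c = k / (q * K) := ⟨_, rfl⟩
  have hc0 : 0 < c := by rw [hc]; positivity
  have hcx : ∀ x : ℝ, k * x / (q * K) = c * x := by intro x; rw [hc]; ring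
  have hcc : c * σmax ^ 2 * Tmax ≤ 1 := by
    have : c * σmax ^ 2 * Tmax = k * σmax ^ 2 * Tmax / (q * K) := by rw [hc]; ring
    rw [this, div_le_one (by positivity)]; exact hcase
  unfold ParetoOptimal
  simp only [hcx, Set.mem_setOf_eq]
  constructor
  · rintro ⟨-, hno⟩
    by_contra hcon
    push Not at hcon
    obtain ⟨h1, h2⟩ := hcon
    have h1 : σ < σmax := lt_of_le_of_ne hσ2 h1
    have h2 : T < Tmax := lt_of_le_of_ne hT2 h2
    apply hno
    obtain ⟨m, hm1, hmT, hmσ⟩ : ∃ m : ℝ, 1 < m ∧ m ^ 2 * T ≤ Tmax ∧ m * σ ≤ σmax := by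
      refine ⟨min (√(Tmax / T)) (σmax / σ), ?_, ?_, ?_⟩
      · apply lt_min
        · rw [Real.lt_sqrt (by norm_num), lt_div_iff₀ hT0]; linarith
        · rw [lt_div_iff₀ hσ1]; linarith
      · rw [← le_div_iff₀ hT0]
        calc _ ≤ (√(Tmax / T)) ^ 2 := by
              apply pow_le_pow_left₀ (le_min (by positivity) (by positivity)) (min_le_left _ _)
          _ = _ := Real.sq_sqrt (by positivity)
      · rw [← le_div_iff₀ hσ1]; exact min_le_right _ _
    have hm0 : 0 < m := by linarith
    have hmm : 1 < m ^ 2 := by nlinarith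
    have hlt : 1 / (m ^ 2 * T) + c * (m * σ) ^ 2 < 1 / T + c * σ ^ 2 := by
      have hb : c * (m * σ) ^ 2 * T < 1 := by
        calc c * (m * σ) ^ 2 * T ≤ c * σmax ^ 2 * T := by gcongr
          _ < c * σmax ^ 2 * Tmax := by gcongr
          _ ≤ 1 := hcc
      have : 1 / T + c * σ ^ 2 - (1 / (m ^ 2 * T) + c * (m * σ) ^ 2)
          = (m ^ 2 - 1) * (1 - c * (m * σ) ^ 2 * T) / (m ^ 2 * T) := by
        field_simp; ring
      have h3 : 0 < (m ^ 2 - 1) * (1 - c * (m * σ) ^ 2 * T) / (m ^ 2 * T) :=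
        div_pos (mul_pos (by linarith) (by linarith)) (by positivity)
      linarith
    refine ⟨(m ^ 2 * T, m * σ), ⟨by dsimp only; nlinarith, hmT, by positivity, hmσ⟩,
      ⟨hlt.le, ?_⟩, Or.inl hlt⟩
    dsimp only
    rw [show q * (m ^ 2 * T) = m ^ 2 * (q * T) by ring, Real.sqrt_mul (by positivity),
      Real.sqrt_sq hm0.le, mul_div_mul_left _ _ hm0.ne']
  · intro hor
    refine ⟨⟨hT1, hT2, hσ1, hσ2⟩, ?_⟩
    rintro ⟨⟨S, τ⟩, ⟨hS1, hS2, hτ1, hτ2⟩, ⟨ha, hb⟩, hs⟩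
    dsimp only at *
    have hS0 : 0 < S := by linarith
    have hkey : S * σ ^ 2 ≤ T * τ ^ 2 := by
      rw [div_le_div_iff₀ hτ1 hσ1] at hb
      have h := pow_le_pow_left₀ (by positivity) hb 2
      rw [mul_pow, mul_pow, Real.sq_sqrt (by positivity), Real.sq_sqrt (by positivity)] at h
      nlinarith
    have hST : S ≤ T := by
      rcases hor with h | h
      · subst h
        have h4 : T * τ ^ 2 ≤ T * σ ^ 2 := by gcongr
        exact le_of_mul_le_mul_right (hkey.trans h4) (by positivity)
      · linarith
    have hTS : S = T := by
      by_contra hne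
      have hlt : S < T := lt_of_le_of_ne hST hne
      have hb1 : c * σ ^ 2 * S < 1 := by
        calc c * σ ^ 2 * S < c * σ ^ 2 * T := by gcongr
          _ ≤ c * σmax ^ 2 * Tmax := by gcongr
          _ ≤ 1 := hcc
      have h5 : c * (S * σ ^ 2 / T) ≤ c * τ ^ 2 := by
        gcongr
        rw [div_le_iff₀ hT0]; linarith
      have h6 : 1 / S + c * (S * σ ^ 2 / T) - (1 / T + c * σ ^ 2)
          = (T - S) * (1 - c * σ ^ 2 * S) / (T * S) := by
        field_simp; ring
      have h7 : 0 < (T - S) * (1 - c * σ ^ 2 * S) / (T * S) :=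
        div_pos (mul_pos (by linarith) (by linarith)) (by positivity)
      linarith
    subst hTS
    have h8 : σ ^ 2 ≤ τ ^ 2 := le_of_mul_le_mul_left hkey hS0
    have h9 : τ ^ 2 ≤ σ ^ 2 := le_of_mul_le_mul_left (by linarith) hc0
    have h10 : τ = σ := le_antisymm ((sq_le_sq₀ hτ1.le hσ1.le).1 h9)
      ((sq_le_sq₀ hσ1.le hτ1.le).1 h8)
    subst h10
    rcases hs with h | h <;> exact lt_irrefl _ h
end
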